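/- arXiv:1908.08574 — 7 statements merged into one kernel-verified Lean document; each statement's English description precedes it below -/
import Mathlib

section
/- Let D ≥ 1, let f : ℝ^D → ℝ^D be differentiable, let γ ∈ ℝ and p₀ ∈ ℝ^D, and let h : ℝ^D → ℝ^D be differentiable at p₀ such that f(h(p) + p) - γ • (h(p) + p) = 0 for all p in a neighborhood of p₀. If the continuous linear map Df(h(p₀) + p₀) - γ • id : ℝ^D → ℝ^D is bijective, then the Fréchet derivative of h at p₀ equals -id. -/
/-- **Lemma 1 (Identity Transition Mapping).** If `h(p)` is an equilibrium point of the
ERNN ODE, i.e. `f (h p + p) - γ • (h p + p) = 0` for all `p` near `p₀`, and the linear map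
`Df(h(p₀) + p₀) - γ • id` is bijective, then `Dh(p₀) = -id`. -/
theorem ernn_identity_transition_mapping
    (D : ℕ) (hD : 1 ≤ D)
    (f : EuclideanSpace ℝ (Fin D) → EuclideanSpace ℝ (Fin D))
    (hf : Differentiable ℝ f)
    (γ : ℝ) (p₀ : EuclideanSpace ℝ (Fin D))
    (h : EuclideanSpace ℝ (Fin D) → EuclideanSpace ℝ (Fin D))
    (hh : DifferentiableAt ℝ h p₀)
    (heq : ∀ᶠ p in nhds p₀, f (h p + p) - γ • (h p + p) = 0)
    (hbij : Function.Bijective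
      (fderiv ℝ f (h p₀ + p₀) - γ • ContinuousLinearMap.id ℝ (EuclideanSpace ℝ (Fin D)))) :
    fderiv ℝ h p₀ = - ContinuousLinearMap.id ℝ (EuclideanSpace ℝ (Fin D)) := by
  have hu : HasFDerivAt (fun p => h p + p)
      (fderiv ℝ h p₀ + ContinuousLinearMap.id ℝ (EuclideanSpace ℝ (Fin D))) p₀ :=
    hh.hasFDerivAt.add (hasFDerivAt_id p₀)
  have hF : HasFDerivAt (fun y => f y - γ • y)
      (fderiv ℝ f (h p₀ + p₀) - γ • ContinuousLinearMap.id ℝ (EuclideanSpace ℝ (Fin D)))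
      (h p₀ + p₀) :=
    (hf _).hasFDerivAt.sub ((hasFDerivAt_id _).const_smul γ)
  have hcomp := HasFDerivAt.comp (f := fun p => h p + p) p₀ hF hu
  have hzero := hcomp.unique ((hasFDerivAt_const 0 p₀).congr_of_eventuallyEq heq)
  refine eq_neg_of_add_eq_zero_left (ContinuousLinearMap.ext fun v => hbij.injective ?_)
  rw [zero_apply, map_zero]
  exact DFunLike.congr_fun hzero v
end

section
/- Let D ≥ 1, let f : ℝ^D → ℝ^D be differentiable, let γ ∈ ℝ and p₀ ∈ ℝ^D, and let h : ℝ^D → ℝ^D be differentiable at p₀ such that f(h(p) - p) - γ • (h(p) - p) = 0 for all p in a neighborhood of p₀. If the continuous linear map Df(h(p₀) - p₀) - γ • id : ℝ^D → ℝ^D is bijective, then the Fréchet derivative of h at p₀ equals +id. -/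
/-- Remark after Lemma 1. If `h(p)` is an equilibrium point of the
ERNN ODE, i.e. `f (h p - p) - γ • (h p - p) = 0` for all `p` near `p₀`, and the linear map
`Df(h(p₀) - p₀) - γ • id` is bijective, then `Dh(p₀) = +id`. -/
theorem ernn_identity_transition_mapping_plus
    (D : ℕ) (hD : 1 ≤ D)
    (f : EuclideanSpace ℝ (Fin D) → EuclideanSpace ℝ (Fin D))
    (hf : Differentiable ℝ f)
    (γ : ℝ) (p₀ : EuclideanSpace ℝ (Fin D))
    (h : EuclideanSpace ℝ (Fin D) → EuclideanSpace ℝ (Fin D))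
    (hh : DifferentiableAt ℝ h p₀)
    (heq : ∀ᶠ p in nhds p₀, f (h p - p) - γ • (h p - p) = 0)
    (hbij : Function.Bijective
      (fderiv ℝ f (h p₀ - p₀) - γ • ContinuousLinearMap.id ℝ (EuclideanSpace ℝ (Fin D)))) :
    fderiv ℝ h p₀ = ContinuousLinearMap.id ℝ (EuclideanSpace ℝ (Fin D)) := by
  have hu : HasFDerivAt (fun p => h p - p)
      (fderiv ℝ h p₀ - ContinuousLinearMap.id ℝ (EuclideanSpace ℝ (Fin D))) p₀ :=
    hh.hasFDerivAt.sub (hasFDerivAt_id p₀)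
  have hg : HasFDerivAt (fun p => f (h p - p) - γ • (h p - p))
      ((fderiv ℝ f (h p₀ - p₀)).comp
        (fderiv ℝ h p₀ - ContinuousLinearMap.id ℝ (EuclideanSpace ℝ (Fin D))) -
        γ • (fderiv ℝ h p₀ - ContinuousLinearMap.id ℝ (EuclideanSpace ℝ (Fin D)))) p₀ :=
    (HasFDerivAt.comp (f := fun p => h p - p) p₀ (hf (h p₀ - p₀)).hasFDerivAt hu).sub (hu.const_smul γ)
  have hzero := hg.unique ((hasFDerivAt_const 0 p₀).congr_of_eventuallyEq heq)
  refine sub_eq_zero.mp (ContinuousLinearMap.ext fun v => hbij.injective ?_)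
  simpa using DFunLike.congr_fun hzero v
end

section
/- Let D ≥ 1 and n < m be natural numbers. For each k with n < k ≤ m, let f_k : ℝ^D → ℝ^D be differentiable, let γ ∈ ℝ, and let g_k : ℝ^D → ℝ^D be differentiable. Define the hidden states recursively by h_k = g_k(h_{k-1}) starting from a given h_n ∈ ℝ^D. Suppose that for each k with n < k ≤ m: (i) f_k(g_k(p) + p) - γ • (g_k(p) + p) = 0 for all p in a neighborhood of h_{k-1}, and (ii) the continuous linear map Df_k(g_k(h_{k-1}) + h_{k-1}) - γ • id is bijective. Then the Fréchet derivative of the composite map g_m ∘ g_{m-1} ∘ ⋯ ∘ g_{n+1} at h_n equals (-1)^{m-n} • id, and in particular its operator norm equals 1. -/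
/-- The composite map `g_m ∘ g_{m-1} ∘ ⋯ ∘ g_{n+1}` (and the identity when `m ≤ n`). -/
def chainComp {E : Type*} (g : ℕ → E → E) (n : ℕ) : ℕ → E → E
  | 0 => id
  | m + 1 => if m + 1 ≤ n then id else g (m + 1) ∘ chainComp g n m

section Backprop

variable {E : Type*} [NormedAddCommGroup E] [NormedSpace ℝ E]

theorem chainComp_self {α : Type*} (g : ℕ → α → α) (n : ℕ) : chainComp g n n = id := by
  cases n <;> simp [chainComp]

theorem chainComp_succ {α : Type*} (g : ℕ → α → α) {n m : ℕ} (h : n ≤ m) :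
    chainComp g n (m + 1) = g (m + 1) ∘ chainComp g n m := by
  rw [chainComp, if_neg (by omega)]

/-- If `p ↦ g p + p` stays among the zeros of `f - γ • id` near `x`, and the derivative of
`f - γ • id` at `g x + x` is injective, then `g` has derivative `-id` at `x`. -/
theorem hasFDerivAt_neg_id_of_equilibrium {f g : E → E} {γ : ℝ} {x : E}
    (hf : DifferentiableAt ℝ f (g x + x)) (hg : DifferentiableAt ℝ g x)
    (heq : ∀ᶠ p in nhds x, f (g p + p) - γ • (g p + p) = 0)
    (hinj : Function.Injective
      (fderiv ℝ f (g x + x) - γ • ContinuousLinearMap.id ℝ E)) :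
    HasFDerivAt g (-ContinuousLinearMap.id ℝ E) x := by
  have hshift : HasFDerivAt (fun p => g p + p)
      (fderiv ℝ g x + ContinuousLinearMap.id ℝ E) x :=
    hg.hasFDerivAt.add (hasFDerivAt_id x)
  have hcomp := (HasFDerivAt.comp (f := fun p => g p + p) x hf.hasFDerivAt hshift).sub (hshift.const_smul γ)
  have hzero := (hasFDerivAt_const (𝕜 := ℝ) (0 : E) x).congr_of_eventuallyEq heq
  have hderiv := hcomp.unique hzero
  have hneg : fderiv ℝ g x = -ContinuousLinearMap.id ℝ E := by
    rw [eq_neg_iff_add_eq_zero]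
    ext1 v
    apply hinj
    simpa using DFunLike.congr_fun hderiv v
  exact hneg ▸ hg.hasFDerivAt

/-- Along a trajectory on which each step has derivative `-id`, the composite of `j` steps
has derivative `(-1) ^ j • id`. -/
theorem chainComp_hasFDerivAt (g : ℕ → E → E) (H : ℕ → E) (n j : ℕ)
    (hH : ∀ i < j, H (n + i + 1) = g (n + i + 1) (H (n + i)))
    (hg : ∀ i < j, HasFDerivAt (g (n + i + 1)) (-ContinuousLinearMap.id ℝ E) (H (n + i))) :
    chainComp g n (n + j) (H n) = H (n + j) ∧
      HasFDerivAt (chainComp g n (n + j))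
        ((-1 : ℝ) ^ j • ContinuousLinearMap.id ℝ E) (H n) := by
  induction j with
  | zero => simpa [chainComp_self] using hasFDerivAt_id (𝕜 := ℝ) (H n)
  | succ j ih =>
    obtain ⟨hval, hder⟩ := ih (fun i hi => hH i (by omega)) (fun i hi => hg i (by omega))
    rw [← add_assoc, chainComp_succ g (Nat.le_add_right n j)]
    refine ⟨by rw [Function.comp_apply, hval, hH j j.lt_succ_self], ?_⟩
    have hstep := hg j j.lt_succ_self
    rw [← hval] at hstep
    refine (hstep.comp (H n) hder).congr_fderiv ?_
    ext1 v
    simp [pow_succ]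

end Backprop

/-- **Theorem 1 (Identity Transition Mapping in Backpropagation of ERNN).**
Along a trajectory `H k = g k (H (k-1))` of equilibrium states of the ERNN recursion,
the backpropagated Jacobian `∂h_m/∂h_n`, i.e. the Fréchet derivative of
`g_m ∘ ⋯ ∘ g_{n+1}` at `H n`, equals `(-1)^{m-n} • id` and has operator norm `1`. -/
theorem ernn_identity_transition_backprop
    (D n m : ℕ) (hD : 1 ≤ D) (hnm : n < m)
    (f g : ℕ → EuclideanSpace ℝ (Fin D) → EuclideanSpace ℝ (Fin D)) (γ : ℝ)
    (hf : ∀ k, n < k → k ≤ m → Differentiable ℝ (f k))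
    (hg : ∀ k, n < k → k ≤ m → Differentiable ℝ (g k))
    (H : ℕ → EuclideanSpace ℝ (Fin D))
    (hH : ∀ k, n < k → k ≤ m → H k = g k (H (k - 1)))
    (heq : ∀ k, n < k → k ≤ m →
      ∀ᶠ p in nhds (H (k - 1)), f k (g k p + p) - γ • (g k p + p) = 0)
    (hbij : ∀ k, n < k → k ≤ m → Function.Bijective
      (fderiv ℝ (f k) (g k (H (k - 1)) + H (k - 1)) -
        γ • ContinuousLinearMap.id ℝ (EuclideanSpace ℝ (Fin D)))) :
    fderiv ℝ (chainComp g n m) (H n) =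
      ((-1 : ℝ)) ^ (m - n) • ContinuousLinearMap.id ℝ (EuclideanSpace ℝ (Fin D)) ∧
    ‖fderiv ℝ (chainComp g n m) (H n)‖ = 1 := by
  obtain ⟨j, rfl⟩ := Nat.exists_eq_add_of_le hnm.le
  have hder := (chainComp_hasFDerivAt g H n j
    (fun i hi => hH (n + i + 1) (by omega) (by omega))
    (fun i hi => hasFDerivAt_neg_id_of_equilibrium
      (hf (n + i + 1) (by omega) (by omega) _) (hg (n + i + 1) (by omega) (by omega) _)
      (heq (n + i + 1) (by omega) (by omega))
      (hbij (n + i + 1) (by omega) (by omega)).injective)).2.fderiv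
  have : Nonempty (Fin D) := ⟨⟨0, hD⟩⟩
  rw [hder, Nat.add_sub_cancel_left]
  exact ⟨rfl, by simp [norm_smul]⟩
end

section
/- Let D ≥ 1, let φ : ℝ^D → ℝ^D be differentiable, let A : ℝ^D → ℝ^D be a continuous linear map, let c ∈ ℝ^D and p₀ ∈ ℝ^D, and let h̃ : ℝ^D → ℝ^D be differentiable at p₀ such that φ(A(h̃(p) + p) + c) = 0 for all p in a neighborhood of p₀. If the composition Dφ(A(h̃(p₀) + p₀) + c) ∘ A : ℝ^D → ℝ^D is bijective, then the Fréchet derivative of h̃ at p₀ equals -id, and consequently the map p ↦ h̃(p) + p has Fréchet derivative 0 at p₀. -/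
/-- Section 1.1 observation: for the unmodified ODE, the reparameterized equilibrium
`h̃ = h - h_{k-1}` satisfies `∂h̃/∂h_{k-1} = -I`, so the original state satisfies
`∂h/∂h_{k-1} = 0`. -/
theorem ernn_unmodified_ode_zero_derivative
    (D : ℕ) (hD : 1 ≤ D)
    (φ : EuclideanSpace ℝ (Fin D) → EuclideanSpace ℝ (Fin D))
    (hφ : Differentiable ℝ φ)
    (A : EuclideanSpace ℝ (Fin D) →L[ℝ] EuclideanSpace ℝ (Fin D))
    (c p₀ : EuclideanSpace ℝ (Fin D))
    (ht : EuclideanSpace ℝ (Fin D) → EuclideanSpace ℝ (Fin D))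
    (hht : DifferentiableAt ℝ ht p₀)
    (heq : ∀ᶠ p in nhds p₀, φ (A (ht p + p) + c) = 0)
    (hbij : Function.Bijective ((fderiv ℝ φ (A (ht p₀ + p₀) + c)).comp A)) :
    fderiv ℝ ht p₀ = - ContinuousLinearMap.id ℝ (EuclideanSpace ℝ (Fin D)) ∧
    fderiv ℝ (fun p => ht p + p) p₀ = 0 := by
  have hsum : HasFDerivAt (fun p => ht p + p)
      (fderiv ℝ ht p₀ + ContinuousLinearMap.id ℝ (EuclideanSpace ℝ (Fin D))) p₀ :=
    hht.hasFDerivAt.add (hasFDerivAt_id p₀)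
  have hinner : HasFDerivAt (fun p => A (ht p + p) + c)
      (A.comp (fderiv ℝ ht p₀ + ContinuousLinearMap.id ℝ (EuclideanSpace ℝ (Fin D)))) p₀ :=
    (A.hasFDerivAt.comp p₀ hsum).add_const c
  have hcomp := (hφ (A (ht p₀ + p₀) + c)).hasFDerivAt.comp p₀ hinner
  have hconst : HasFDerivAt (φ ∘ fun p => A (ht p + p) + c)
      (0 : EuclideanSpace ℝ (Fin D) →L[ℝ] EuclideanSpace ℝ (Fin D)) p₀ :=
    (hasFDerivAt_const 0 p₀).congr_of_eventuallyEq heq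
  have hzero : fderiv ℝ ht p₀ + ContinuousLinearMap.id ℝ (EuclideanSpace ℝ (Fin D)) = 0 := by
    refine ContinuousLinearMap.ext fun v => hbij.injective ?_
    rw [zero_apply, map_zero]
    exact DFunLike.congr_fun (hcomp.unique hconst) v
  exact ⟨eq_neg_of_add_eq_zero_left hzero, hsum.fderiv.trans hzero⟩
end

section
/- Let D ≥ 1, let Δ be a real D×D diagonal matrix whose diagonal entries all lie in the interval (0, 1], let U be a real D×D matrix, and let γ > 0 satisfy ‖U‖ < γ, where ‖·‖ is the operator norm induced by the Euclidean norm on ℝ^D. Then every eigenvalue λ ∈ ℂ of the complexification of the matrix Δ·U - γ·I has negative real part. -/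
/-- The Euclidean operator norm bound for a real matrix, in terms of sums of squares. -/
lemma sum_sq_mulVec_le {n : Type*} [Fintype n] [DecidableEq n] (U : Matrix n n ℝ) (x : n → ℝ) :
    ∑ i, (U.mulVec x i) ^ 2 ≤ ‖Matrix.toEuclideanCLM (𝕜 := ℝ) U‖ ^ 2 * ∑ i, x i ^ 2 := by
  have h := pow_le_pow_left₀ (norm_nonneg _)
    ((Matrix.toEuclideanCLM (𝕜 := ℝ) U).le_opNorm (WithLp.toLp 2 x)) 2
  rw [mul_pow, EuclideanSpace.real_norm_sq_eq, EuclideanSpace.real_norm_sq_eq] at h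
  simpa using h

/-- Complexifying a real matrix does not increase its Euclidean operator norm. -/
lemma sum_normSq_map_mulVec_le {n : Type*} [Fintype n] [DecidableEq n]
    (U : Matrix n n ℝ) (v : n → ℂ) :
    ∑ i, Complex.normSq ((U.map (algebraMap ℝ ℂ)).mulVec v i) ≤
      ‖Matrix.toEuclideanCLM (𝕜 := ℝ) U‖ ^ 2 * ∑ i, Complex.normSq (v i) := by
  have hre (i) : ((U.map (algebraMap ℝ ℂ)).mulVec v i).re = U.mulVec (fun j ↦ (v j).re) i := by
    simp [Matrix.mulVec, dotProduct]
  have him (i) : ((U.map (algebraMap ℝ ℂ)).mulVec v i).im = U.mulVec (fun j ↦ (v j).im) i := by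
    simp [Matrix.mulVec, dotProduct]
  simp only [Complex.normSq_apply, hre, him, ← pow_two, Finset.sum_add_distrib, mul_add]
  exact add_le_add (sum_sq_mulVec_le U _) (sum_sq_mulVec_le U _)

/-- Claim following Lemma 2: if `Δ` is diagonal with entries in `(0,1]`, `γ > 0`, and the
Euclidean operator norm of `U` is less than `γ`, then every complex eigenvalue of
`Δ·U - γ·I` has negative real part. -/
theorem ernn_jacobian_negative_eigenvalues
    (D : ℕ) (hD : 1 ≤ D)
    (d : Fin D → ℝ) (hd : ∀ i, 0 < d i ∧ d i ≤ 1)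
    (U : Matrix (Fin D) (Fin D) ℝ) (γ : ℝ) (hγ : 0 < γ)
    (hU : ‖Matrix.toEuclideanCLM (𝕜 := ℝ) U‖ < γ) :
    ∀ μ : ℂ, Module.End.HasEigenvalue
      (Matrix.toLin' ((Matrix.diagonal d * U - γ • 1).map (algebraMap ℝ ℂ))) μ →
      μ.re < 0 := by
  intro μ hμ
  obtain ⟨v, hv⟩ := hμ.exists_hasEigenvector
  have hmat : (Matrix.diagonal d * U - γ • 1).map (algebraMap ℝ ℂ) =
      Matrix.diagonal (fun i ↦ (d i : ℂ)) * U.map (algebraMap ℝ ℂ) - (γ : ℂ) • 1 := by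
    ext i j
    by_cases hij : i = j <;> simp [Matrix.diagonal_mul, hij]
  have heq (i) : (d i : ℂ) * (U.map (algebraMap ℝ ℂ)).mulVec v i = (μ + γ) * v i := by
    have h := congrFun hv.apply_eq_smul i
    rw [Matrix.toLin'_apply, hmat, Matrix.sub_mulVec, ← Matrix.mulVec_mulVec,
      Matrix.smul_mulVec, Matrix.one_mulVec] at h
    simp only [Pi.sub_apply, Matrix.mulVec_diagonal, Pi.smul_apply, smul_eq_mul] at h
    linear_combination h
  have hpos : 0 < ∑ i, Complex.normSq (v i) := by
    obtain ⟨i, hi⟩ := Function.ne_iff.mp hv.2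
    exact Finset.sum_pos' (fun _ _ ↦ Complex.normSq_nonneg _)
      ⟨i, Finset.mem_univ i, Complex.normSq_pos.mpr hi⟩
  have hle : Complex.normSq (μ + γ) * ∑ i, Complex.normSq (v i) ≤
      ‖Matrix.toEuclideanCLM (𝕜 := ℝ) U‖ ^ 2 * ∑ i, Complex.normSq (v i) := by
    refine le_trans ?_ (sum_normSq_map_mulVec_le U v)
    rw [Finset.mul_sum]
    refine Finset.sum_le_sum fun i _ ↦ ?_
    rw [← Complex.normSq_mul, ← heq i, Complex.normSq_mul, Complex.normSq_ofReal]
    exact mul_le_of_le_one_left (Complex.normSq_nonneg _)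
      (mul_le_one₀ (hd i).2 (hd i).1.le (hd i).2)
  have hbound := le_of_mul_le_mul_right hle hpos
  have hlt := pow_lt_pow_left₀ hU (norm_nonneg _) two_ne_zero
  by_contra! hre
  simp only [Complex.normSq_apply, Complex.add_re, Complex.ofReal_re, Complex.add_im,
    Complex.ofReal_im, add_zero] at hbound
  nlinarith [mul_nonneg hre hγ.le, mul_self_nonneg μ.re, mul_self_nonneg μ.im]
end

section
/- Let n ≥ 1 and let F : ℝ^n → ℝ^n be continuously differentiable in a neighborhood of a point z* with F(z*) = 0 and with the Jacobian DF(z*) invertible. Let 0 ≤ τ < 1 and let (z^{(i)})_{i≥0} be a sequence in ℝ^n satisfying z^{(i+1)} = z^{(i)} + s^{(i)} where the steps s^{(i)} satisfy the inexact-Newton residual bound ‖F(z^{(i)}) + DF(z^{(i)}) s^{(i)}‖ ≤ τ ‖F(z^{(i)})‖ for all i. Then for every t with τ < t < 1 there exists ε > 0 such that whenever ‖z^{(0)} - z*‖ ≤ ε, the sequence (z^{(i)}) converges to z* and moreover ‖DF(z*)(z^{(i+1)} - z*)‖ ≤ t ‖DF(z*)(z^{(i)} - z*)‖ for all i. -/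
open Filter

/-- Near a zero `x` of `F` at which the derivative is continuous and bounded below, every step with
relative residual at most `τ` contracts the norm `‖fderiv ℝ F x ·‖` by any prescribed factor
`t ∈ (τ, 1)`. -/
theorem eventually_norm_fderiv_inexact_newton_step_le
    {E G : Type*} [NormedAddCommGroup E] [NormedSpace ℝ E]
    [NormedAddCommGroup G] [NormedSpace ℝ G] {F : E → G} {x : E} {C τ t : ℝ}
    (hd : DifferentiableAt ℝ F x) (hc : ContinuousAt (fderiv ℝ F) x) (hx : F x = 0)
    (hC : 0 < C) (hA : ∀ y, ‖y‖ ≤ C * ‖fderiv ℝ F x y‖)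
    (hτ : 0 ≤ τ) (hτt : τ < t) (ht : t < 1) :
    ∀ᶠ z in nhds x, ∀ s, ‖F z + fderiv ℝ F z s‖ ≤ τ * ‖F z‖ →
      ‖fderiv ℝ F x (z + s - x)‖ ≤ t * ‖fderiv ℝ F x (z - x)‖ := by
  obtain ⟨δ, hδ⟩ : ∃ δ, δ = (t - τ) / 4 := ⟨_, rfl⟩
  have hδ0 : 0 < δ := by linarith
  have hδC : 0 < δ / C := div_pos hδ0 hC
  have hlin := hd.hasFDerivAt.isLittleO.def hδC
  have hclose := Metric.tendsto_nhds.1 hc (δ / C) hδC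
  filter_upwards [hlin, hclose] with z hz hz' s hs
  set A := fderiv ℝ F x
  set B := fderiv ℝ F z
  rw [hx, sub_zero] at hz
  rw [dist_eq_norm] at hz'
  have bound : ∀ y, δ / C * ‖y‖ ≤ δ * ‖A y‖ := fun y => by
    calc δ / C * ‖y‖ ≤ δ / C * (C * ‖A y‖) := by gcongr; exact hA y
      _ = δ * ‖A y‖ := by field_simp
  have hρ : ‖F z - A (z - x)‖ ≤ δ * ‖A (z - x)‖ := hz.trans (bound _)
  have hBs : ‖(B - A) s‖ ≤ δ * ‖A s‖ :=
    ((B - A).le_of_opNorm_le hz'.le s).trans (bound s)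
  have hFz : ‖F z‖ ≤ (1 + δ) * ‖A (z - x)‖ := by
    have := norm_le_norm_add_norm_sub' (F z) (A (z - x))
    linarith
  have hAs : ‖A s‖ ≤ ‖A (z + s - x)‖ + ‖A (z - x)‖ := by
    have h : A s = A (z + s - x) - A (z - x) := by rw [← map_sub]; congr 1; abel
    rw [h]
    exact norm_sub_le _ _
  have hsplit : A (z + s - x) = (F z + B s) - (F z - A (z - x)) - (B - A) s := by
    rw [show z + s - x = (z - x) + s by abel, map_add, sub_apply]
    abel
  have hmain : ‖A (z + s - x)‖ ≤
      ‖F z + B s‖ + ‖F z - A (z - x)‖ + ‖(B - A) s‖ := by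
    conv_lhs => rw [hsplit]
    exact (norm_sub_le _ _).trans (by gcongr; exact norm_sub_le _ _)
  have hres : ‖F z + B s‖ ≤ τ * ((1 + δ) * ‖A (z - x)‖) := hs.trans (by gcongr)
  have hδs := mul_le_mul_of_nonneg_left hAs hδ0.le
  have hcoef : τ * (1 + δ) + 2 * δ ≤ t * (1 - δ) := by
    nlinarith
  have hcoef' := mul_le_mul_of_nonneg_right hcoef (norm_nonneg (A (z - x)))
  have h1δ : 0 < 1 - δ := by linarith
  refine le_of_mul_le_mul_left ?_ h1δ
  linarith

/-- **Inexact Newton convergence** (Dembo–Eisenstat–Steihaug, Thm. 2.3; Lemma 1 of the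
paper's supplementary): any inexact Newton iteration with residual ratio at most `τ < 1`
converges locally, linearly in the norm `‖y‖_* = ‖DF(z*) y‖`. -/
theorem inexact_newton_local_linear_convergence
    (n : ℕ) (hn : 1 ≤ n)
    (F : EuclideanSpace ℝ (Fin n) → EuclideanSpace ℝ (Fin n))
    (zstar : EuclideanSpace ℝ (Fin n))
    (hF : ∃ U ∈ nhds zstar, ContDiffOn ℝ 1 F U)
    (hFz : F zstar = 0)
    (hinv : Function.Bijective (fderiv ℝ F zstar))
    (τ : ℝ) (hτ0 : 0 ≤ τ) (hτ1 : τ < 1) :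
    ∀ t : ℝ, τ < t → t < 1 → ∃ ε > 0,
      ∀ z s : ℕ → EuclideanSpace ℝ (Fin n),
        (∀ i, z (i + 1) = z i + s i) →
        (∀ i, ‖F (z i) + fderiv ℝ F (z i) (s i)‖ ≤ τ * ‖F (z i)‖) →
        ‖z 0 - zstar‖ ≤ ε →
        Tendsto z atTop (nhds zstar) ∧
        ∀ i, ‖fderiv ℝ F zstar (z (i + 1) - zstar)‖ ≤
          t * ‖fderiv ℝ F zstar (z i - zstar)‖ := by
  intro t hτt ht1
  obtain ⟨U, hU, hFU⟩ := hF
  have hcd : ContDiffAt ℝ 1 F zstar := hFU.contDiffAt hU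
  obtain ⟨K, hK, hanti⟩ := (fderiv ℝ F zstar).toLinearMap.exists_antilipschitzWith
    (LinearMap.ker_eq_bot.2 hinv.1)
  have hC : (0 : ℝ) < K := hK
  have hA : ∀ y, ‖y‖ ≤ K * ‖fderiv ℝ F zstar y‖ := fun y => by
    simpa using hanti.le_mul_dist y 0
  obtain ⟨r, hr, hstep⟩ := Metric.eventually_nhds_iff.1
    (eventually_norm_fderiv_inexact_newton_step_le (hcd.differentiableAt one_ne_zero)
      (hcd.continuousAt_fderiv one_ne_zero) hFz hC hA hτ0 hτt ht1)
  have hcont : ContinuousAt (fun z => ‖fderiv ℝ F zstar (z - zstar)‖) zstar := by fun_prop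
  obtain ⟨ε, hε, hball⟩ := Metric.nhds_basis_closedBall.eventually_iff.1
    (hcont.eventually_lt_const (u := ‖fderiv ℝ F zstar (zstar - zstar)‖ + r / K)
      (lt_add_of_pos_right _ (div_pos hr hC)))
  refine ⟨ε, hε, fun z s hz hs h0 => ?_⟩
  have ht0 : 0 ≤ t := hτ0.trans hτt.le
  have hinit : ‖fderiv ℝ F zstar (z 0 - zstar)‖ < r / K := by
    simpa using hball (mem_closedBall_iff_norm.2 h0)
  have hcontr : ∀ i, ‖fderiv ℝ F zstar (z i - zstar)‖ < r / K →
      ‖fderiv ℝ F zstar (z (i + 1) - zstar)‖ ≤ t * ‖fderiv ℝ F zstar (z i - zstar)‖ := by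
    intro i hi
    rw [hz i]
    refine hstep ?_ (s i) (hs i)
    rw [dist_eq_norm]
    exact (hA _).trans_lt ((lt_div_iff₀' hC).1 hi)
  have hsmall : ∀ i, ‖fderiv ℝ F zstar (z i - zstar)‖ < r / K := by
    intro i
    induction i with
    | zero => exact hinit
    | succ i ih =>
      exact ((hcontr i ih).trans (mul_le_of_le_one_left (norm_nonneg _) ht1.le)).trans_lt ih
  have hlin := fun i => hcontr i (hsmall i)
  refine ⟨?_, hlin⟩
  have hgeom : ∀ i, ‖z i - zstar‖ ≤ K * (t ^ i * ‖fderiv ℝ F zstar (z 0 - zstar)‖) := fun i =>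
    (hA _).trans (mul_le_mul_of_nonneg_left
      (le_geom (u := fun i => ‖fderiv ℝ F zstar (z i - zstar)‖) ht0 i fun k _ => hlin k) hC.le)
  rw [tendsto_iff_norm_sub_tendsto_zero]
  refine squeeze_zero (fun _ => norm_nonneg _) hgeom ?_
  simpa using ((tendsto_pow_atTop_nhds_zero_of_lt_one ht0 ht1).mul_const
    ‖fderiv ℝ F zstar (z 0 - zstar)‖).const_mul (K : ℝ)
end

section
/- Let D ≥ 1 and let F : ℝ^D → ℝ^D be continuously differentiable in a neighborhood of a point h* with F(h*) = 0 and the Jacobian DF(h*) invertible. Let (η_i)_{i≥0} be real numbers and define the Euler iterates h^{(i+1)} = h^{(i)} + η_i • F(h^{(i)}). Suppose there exists τ with 0 ≤ τ < 1 such that ‖id + η_i • DF(h^{(i)})‖ ≤ τ (operator norm) for all i. Then for every t with τ < t < 1 there exists ε > 0 such that whenever ‖h^{(0)} - h*‖ ≤ ε, the sequence (h^{(i)}) converges to h* and ‖DF(h*)(h^{(i+1)} - h*)‖ ≤ t ‖DF(h*)(h^{(i)} - h*)‖ for all i. -/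
open Filter

/-- Near a zero `x₀` of `F` with bounded-below derivative, every Euler step which is stable with
constant `τ` contracts the linearized residual by any prescribed factor `t > τ`. -/
theorem eventually_norm_euler_step_le {E : Type*} [NormedAddCommGroup E] [NormedSpace ℝ E]
    {F : E → E} {x₀ : E} (hd : DifferentiableAt ℝ F x₀) (hc : ContinuousAt (fderiv ℝ F) x₀)
    (hz : F x₀ = 0) (hne : fderiv ℝ F x₀ ≠ 0) {K : ℝ} (hK : 0 ≤ K)
    (hbelow : ∀ v, ‖v‖ ≤ K * ‖fderiv ℝ F x₀ v‖) {τ t : ℝ} (hτ : τ < 1) (ht : τ < t) :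
    ∀ᶠ x in nhds x₀, ∀ η : ℝ, ‖ContinuousLinearMap.id ℝ E + η • fderiv ℝ F x‖ ≤ τ →
      ‖fderiv ℝ F x₀ (x + η • F x - x₀)‖ ≤ t * ‖fderiv ℝ F x₀ (x - x₀)‖ := by
  set A := fderiv ℝ F x₀ with hA
  have hM : 0 < ‖A‖ := norm_pos_iff.mpr hne
  have hC : 0 < 4 / ‖A‖ * (1 + ‖A‖ * K) := by positivity
  obtain ⟨δ, hδ, hδM, hδt⟩ :
      ∃ δ > 0, δ ≤ ‖A‖ / 2 ∧ 4 / ‖A‖ * (1 + ‖A‖ * K) * δ ≤ t - τ := by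
    refine ⟨min (‖A‖ / 2) ((t - τ) / (4 / ‖A‖ * (1 + ‖A‖ * K))),
      lt_min (by positivity) (div_pos (sub_pos.mpr ht) hC), min_le_left _ _, ?_⟩
    rw [mul_comm, ← le_div_iff₀ hC]
    exact min_le_right _ _
  filter_upwards [Metric.continuousAt_iff'.mp hc δ hδ, hd.hasFDerivAt.isLittleO.def hδ]
    with x hclose hrem η hstable
  rw [hz, sub_zero, ← hA] at hrem
  rw [dist_comm, dist_eq_norm, ← hA] at hclose
  have hη : |η| ≤ 4 / ‖A‖ := by
    have h1 : |η| * ‖fderiv ℝ F x‖ ≤ 2 := by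
      calc |η| * ‖fderiv ℝ F x‖
          = ‖(ContinuousLinearMap.id ℝ E + η • fderiv ℝ F x) - ContinuousLinearMap.id ℝ E‖ := by
            rw [add_sub_cancel_left, norm_smul, Real.norm_eq_abs]
        _ ≤ τ + 1 := (norm_sub_le _ _).trans
            (add_le_add hstable ContinuousLinearMap.norm_id_le)
        _ ≤ 2 := by linarith
    have h2 : ‖A‖ / 2 ≤ ‖fderiv ℝ F x‖ := by
      linarith [norm_sub_norm_le A (fderiv ℝ F x)]
    rw [le_div_iff₀ hM]
    linarith [mul_le_mul_of_nonneg_left h2 (abs_nonneg η)]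
  set y := A (x - x₀) with hy
  have hsplit : A (x + η • F x - x₀) =
      (ContinuousLinearMap.id ℝ E + η • fderiv ℝ F x) y + η • (A - fderiv ℝ F x) y
        + η • A (F x - y) := by
    simp only [map_add, map_sub, map_smul, add_apply, sub_apply,
      smul_apply, ContinuousLinearMap.id_apply, smul_sub, hy]
    abel
  have h1 : ‖(ContinuousLinearMap.id ℝ E + η • fderiv ℝ F x) y‖ ≤ τ * ‖y‖ :=
    ContinuousLinearMap.le_of_opNorm_le _ hstable y
  have h2 : ‖η • (A - fderiv ℝ F x) y‖ ≤ 4 / ‖A‖ * (δ * ‖y‖) := by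
    rw [norm_smul, Real.norm_eq_abs]
    gcongr
    exact ContinuousLinearMap.le_of_opNorm_le _ hclose.le y
  have h3 : ‖η • A (F x - y)‖ ≤ 4 / ‖A‖ * (‖A‖ * (δ * (K * ‖y‖))) := by
    rw [norm_smul, Real.norm_eq_abs]
    gcongr
    refine (A.le_opNorm _).trans ?_
    gcongr
    refine hrem.trans ?_
    gcongr
    exact hbelow _
  calc ‖A (x + η • F x - x₀)‖
      ≤ τ * ‖y‖ + 4 / ‖A‖ * (δ * ‖y‖) + 4 / ‖A‖ * (‖A‖ * (δ * (K * ‖y‖))) := by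
        rw [hsplit]
        exact (norm_add₃_le).trans (by gcongr)
    _ = (τ + 4 / ‖A‖ * (1 + ‖A‖ * K) * δ) * ‖y‖ := by ring
    _ ≤ t * ‖y‖ := by gcongr; linarith

/-- **Corollary to Theorem 2.** If the forward propagation of the Euler method is stable,
`‖id + η_i • DF(h^{(i)})‖ ≤ τ < 1`, then the Euler iterates for the ERNN equilibrium
equation `F(h) = 0` converge locally at a linear rate. -/
theorem ernn_euler_local_linear_convergence_of_stability
    (D : ℕ) (hD : 1 ≤ D)
    (F : EuclideanSpace ℝ (Fin D) → EuclideanSpace ℝ (Fin D))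
    (hstar : EuclideanSpace ℝ (Fin D))
    (hF : ∃ U ∈ nhds hstar, ContDiffOn ℝ 1 F U)
    (hFz : F hstar = 0)
    (hinv : Function.Bijective (fderiv ℝ F hstar))
    (τ : ℝ) (hτ0 : 0 ≤ τ) (hτ1 : τ < 1) :
    ∀ t : ℝ, τ < t → t < 1 → ∃ ε > 0,
      ∀ (η : ℕ → ℝ) (h : ℕ → EuclideanSpace ℝ (Fin D)),
        (∀ i, h (i + 1) = h i + η i • F (h i)) →
        (∀ i, ‖ContinuousLinearMap.id ℝ (EuclideanSpace ℝ (Fin D)) +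
            η i • fderiv ℝ F (h i)‖ ≤ τ) →
        ‖h 0 - hstar‖ ≤ ε →
        Tendsto h atTop (nhds hstar) ∧
        ∀ i, ‖fderiv ℝ F hstar (h (i + 1) - hstar)‖ ≤
          t * ‖fderiv ℝ F hstar (h i - hstar)‖ := by
  obtain ⟨U, hU, hFU⟩ := hF
  have hcd : ContDiffAt ℝ 1 F hstar := hFU.contDiffAt hU
  set A := fderiv ℝ F hstar with hA
  obtain ⟨K, -, hK⟩ := A.toLinearMap.exists_antilipschitzWith
    (LinearMap.ker_eq_bot.mpr hinv.injective)
  have hbelow (v : EuclideanSpace ℝ (Fin D)) : ‖v‖ ≤ K * ‖A v‖ := by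
    exact hK.le_mul_norm (map_zero A) v
  have hne : A ≠ 0 := by
    intro h0
    have : Nonempty (Fin D) := ⟨⟨0, hD⟩⟩
    obtain ⟨v, hv⟩ := exists_ne (0 : EuclideanSpace ℝ (Fin D))
    exact hv (hinv.injective (by simp [h0]))
  intro t ht ht1
  have ht0 : 0 ≤ t := hτ0.trans ht.le
  obtain ⟨r, hr, hstep⟩ := Metric.eventually_nhds_iff.mp <|
    eventually_norm_euler_step_le (hcd.differentiableAt one_ne_zero)
      (hcd.continuousAt_fderiv one_ne_zero) hFz hne K.coe_nonneg hbelow hτ1 ht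
  have hC : 0 < K * ‖A‖ + 1 := by positivity
  refine ⟨r / 2 / (K * ‖A‖ + 1), by positivity, fun η h hiter hstable h0 => ?_⟩
  have hsmall : K * ‖A (h 0 - hstar)‖ < r := by
    rw [le_div_iff₀ hC] at h0
    have := mul_le_mul_of_nonneg_left (A.le_opNorm (h 0 - hstar)) K.coe_nonneg
    nlinarith [norm_nonneg (h 0 - hstar)]
  have hcontract (i : ℕ) (hi : ‖A (h i - hstar)‖ ≤ t ^ i * ‖A (h 0 - hstar)‖) :
      ‖A (h (i + 1) - hstar)‖ ≤ t * ‖A (h i - hstar)‖ := by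
    rw [hiter i]
    refine hstep ?_ (η i) (hstable i)
    rw [dist_eq_norm]
    refine (hbelow _).trans_lt (lt_of_le_of_lt ?_ hsmall)
    gcongr
    exact hi.trans (mul_le_of_le_one_left (norm_nonneg _) (pow_le_one₀ ht0 ht1.le))
  have hgeom (i : ℕ) : ‖A (h i - hstar)‖ ≤ t ^ i * ‖A (h 0 - hstar)‖ := by
    induction i with
    | zero => simp
    | succ i ih =>
      calc ‖A (h (i + 1) - hstar)‖ ≤ t * ‖A (h i - hstar)‖ := hcontract i ih
        _ ≤ t * (t ^ i * ‖A (h 0 - hstar)‖) := by gcongr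
        _ = t ^ (i + 1) * ‖A (h 0 - hstar)‖ := by ring
  refine ⟨?_, fun i => hcontract i (hgeom i)⟩
  rw [tendsto_iff_norm_sub_tendsto_zero]
  refine squeeze_zero (fun _ => norm_nonneg _)
    (fun i => (hbelow _).trans (mul_le_mul_of_nonneg_left (hgeom i) K.coe_nonneg)) ?_
  simpa using ((tendsto_pow_atTop_nhds_zero_of_lt_one ht0 ht1).mul_const
    ‖A (h 0 - hstar)‖).const_mul (K : ℝ)
end
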